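/- arXiv:2002.10850 — 2 statements merged into one kernel-verified Lean document; each statement's English description precedes it below -/
import Mathlib

section
/- For any β > 0, L > 0, any fixed rotation matrix Q ∈ 𝔪, any point x ∈ ℝ² and any p ≥ 1, there exists a constant c > 0 such that for all n, inf_{f̃} sup_{f ∈ F(β,L,{Q})} R_n^{(p)}[f̃, f] ≥ c · n^{−β/(2β+1)}, where the infimum is taken over all estimators f̃. -/
open MeasureTheory Matrix Filter
open scoped Classical ENNReal

noncomputable section

/-- Vectors in `ℝ²`. -/
abbrev V2 : Type := Fin 2 → ℝ

/-- `2 × 2` real matrices. -/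
abbrev Mat2 : Type := Matrix (Fin 2) (Fin 2) ℝ

/-- `Q` is a `2 × 2` rotation matrix, i.e. `Q = (q, q⊥)` with `q = (q₁,q₂)ᵀ`,
`q⊥ = (-q₂,q₁)ᵀ` and `q₁² + q₂² = 1`. -/
def IsRotation (Q : Mat2) : Prop :=
  Q 0 0 = Q 1 1 ∧ Q 0 1 = -Q 1 0 ∧ Q 0 0 ^ 2 + Q 1 0 ^ 2 = 1

/-- The `j`-th column of a `2 × 2` matrix. -/
def mcol (Q : Mat2) (j : Fin 2) : V2 := fun i => Q i j

/-- `p₁(D,Q) = qᵀ d⊥`. -/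
def p1 (D Q : Mat2) : ℝ := mcol Q 0 ⬝ᵥ mcol D 1

/-- `p₂(D,Q) = qᵀ d`. -/
def p2 (D Q : Mat2) : ℝ := mcol Q 0 ⬝ᵥ mcol D 0

/-- `ρ(D,Q) = min (|p₁(Q,D)|, |p₂(D,Q)|)`. -/
def rho (D Q : Mat2) : ℝ := min |p1 Q D| |p2 D Q|

/-- A finite set of rotation matrices whose distinct elements are pairwise
`δ`-distinguishable with respect to `ρ`. -/
def IsSep (δ : ℝ) (S : Finset Mat2) : Prop :=
  (∀ M ∈ S, IsRotation M) ∧ ∀ M ∈ S, ∀ M' ∈ S, M ≠ M' → δ ≤ rho M M'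

/-- The Hölder class `H(β,L)` on `ℝ`: with `r = ⌈β⌉ - 1` and `α = β - r ∈ (0,1]`,
`w` is `r` times continuously differentiable, all derivatives up to order `r` are
bounded by `L`, and the `r`-th derivative is `α`-Hölder with constant `L`. -/
def holder (β L : ℝ) (w : ℝ → ℝ) : Prop :=
  ContDiff ℝ ((⌈β⌉₊ - 1 : ℕ) : ℕ∞) w ∧
    (∀ j : ℕ, j ≤ ⌈β⌉₊ - 1 → ∀ y : ℝ, |iteratedDeriv j w y| ≤ L) ∧
    ∀ y z : ℝ,
      |iteratedDeriv (⌈β⌉₊ - 1) w (y + z) - iteratedDeriv (⌈β⌉₊ - 1) w y| ≤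
        L * |z| ^ (β - ((⌈β⌉₊ - 1 : ℕ) : ℝ))

/-- The class `G(β,L)` of product densities `g(x₁,x₂) = g₁(x₁) g₂(x₂)` where
`g₁, g₂` are symmetric probability densities in `H(β,L)`. -/
def memG (β L : ℝ) (g : V2 → ℝ) : Prop :=
  ∃ g₁ g₂ : ℝ → ℝ,
    holder β L g₁ ∧ holder β L g₂ ∧ (∀ y, 0 ≤ g₁ y) ∧ (∀ y, 0 ≤ g₂ y) ∧
      (∀ y, g₁ (-y) = g₁ y) ∧ (∀ y, g₂ (-y) = g₂ y) ∧
      (∫ y, g₁ y) = 1 ∧ (∫ y, g₂ y) = 1 ∧ ∀ v : V2, g v = g₁ (v 0) * g₂ (v 1)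

/-- The class `F(β,L,𝒬)` of densities `f(∙) = g(Mᵀ∙)` with `g ∈ G(β,L)`, `M ∈ 𝒬`
a rotation matrix. -/
def memF (β L : ℝ) (S : Set Mat2) (f : V2 → ℝ) : Prop :=
  ∃ g : V2 → ℝ, memG β L g ∧ ∃ M ∈ S, IsRotation M ∧ ∀ v : V2, f v = g (Mᵀ *ᵥ v)

/-- The measure on `ℝ²` with density `f` with respect to the Lebesgue measure. -/
def densM (f : V2 → ℝ) : Measure V2 :=
  MeasureTheory.volume.withDensity fun y => ENNReal.ofReal (f y)

/-- The joint law of `n` i.i.d. observations with common density `f`. -/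
def jointM (n : ℕ) (f : V2 → ℝ) : Measure (Fin n → V2) :=
  Measure.pi fun _ => densM f

/-- The pointwise risk `R_n^{(p)}[T, f] = (E_f |T - f(x)|^p)^{1/p}` (in `ℝ≥0∞`). -/
def risk (p : ℝ) (n : ℕ) (x : V2) (f : V2 → ℝ) (T : (Fin n → V2) → ℝ) : ℝ≥0∞ :=
  (∫⁻ ω, ENNReal.ofReal |T ω - f x| ^ p ∂jointM n f) ^ (1 / p)

/-- The kernel class `𝕂_β`: integrable, bounded, integrating to one, with vanishing
moments up to order `2⌊β⌋` and finite moment of order `2β`. -/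
def memK (β : ℝ) (K : ℝ → ℝ) : Prop :=
  Integrable K ∧ (∃ C, ∀ u, |K u| ≤ C) ∧ (∫ u, K u) = 1 ∧
    (∀ j : ℕ, 1 ≤ j → j ≤ 2 * ⌊β⌋₊ → (∫ u, K u * u ^ j) = 0) ∧
    Integrable fun t => |K t| * |t| ^ (2 * β)

/-- The constant `C(K,β,s)`. -/
def CK (K : ℝ → ℝ) (β s : ℝ) : ℝ :=
  ⨆ b : {b : ℝ // b ≤ β},
    ∫ t : ℝ × ℝ, |K t.1 * K t.2| * (s * (t.1 ^ 2 + t.2 ^ 2) ^ (b : ℝ) + 1) ^ 2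

/-- The rescaled kernel `K_h(u) = h⁻¹ K(u/h)`. -/
def Kh (K : ℝ → ℝ) (h u : ℝ) : ℝ := h⁻¹ * K (u / h)

/-- The bivariate product kernel `K_h(t) = K_h(t₁) K_h(t₂)`. -/
def K2 (K : ℝ → ℝ) (h : ℝ) (t : V2) : ℝ := Kh K h (t 0) * Kh K h (t 1)

/-- The matrix `Γ = [[1,0],[0,-1]]`. -/
def Γm : Mat2 := !![1, 0; 0, -1]

/-- The matrix `Ω = [[0,1],[1,0]]`. -/
def Ωm : Mat2 := !![0, 1; 1, 0]

/-- Marginal kernel estimator in direction `b`, built from the observations with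
indices in `I`. -/
def margEstI (K : ℝ → ℝ) (h : ℝ) (b x : V2) {n : ℕ} (I : Finset (Fin n))
    (ω : Fin n → V2) : ℝ :=
  (I.card : ℝ)⁻¹ * ∑ k ∈ I, Kh K h (b ⬝ᵥ (ω k - x))

/-- The estimator `f̃_{h,D}(x)`: product of the marginal estimators along the two
columns of `D`, built from the observations with indices in `I`. -/
def prodEstI (K : ℝ → ℝ) (h : ℝ) (D : Mat2) (x : V2) {n : ℕ} (I : Finset (Fin n))
    (ω : Fin n → V2) : ℝ :=
  margEstI K h (mcol D 0) x I ω * margEstI K h (mcol D 1) x I ω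

/-- The auxiliary `U`-statistic estimator `f̄_{h,(D,Q)}(x)`. -/
def auxEstI (K : ℝ → ℝ) (h : ℝ) (D Q : Mat2) (x : V2) {n : ℕ} (I : Finset (Fin n))
    (ω : Fin n → V2) : ℝ :=
  ((I.card : ℝ) * ((I.card : ℝ) - 1))⁻¹ *
    ∑ k ∈ I, ∑ l ∈ I,
      if k = l then 0
      else
        K2 K h
          (p1 D Q • ((Ωm * Γm) *ᵥ ω k) + p2 D Q • ω l - (Ωm * Γm * Q * D * Ωm) *ᵥ x)

/-- `f̃_{h,(D,Q)}(x)`: the auxiliary estimator if `D ≠ Q`, and `f̃_{h,Q}(x)` if `D = Q`. -/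
def pairEstI (K : ℝ → ℝ) (h : ℝ) (D Q : Mat2) (x : V2) {n : ℕ} (I : Finset (Fin n))
    (ω : Fin n → V2) : ℝ :=
  if D = Q then prodEstI K h Q x I ω else auxEstI K h D Q x I ω

/-- The bandwidth grid `𝓗 = {e^{-k}, k = 0, …, ⌊ln ν⌋}`. -/
def Hgrid (ν : ℕ) : Finset ℝ :=
  (Finset.range (⌊Real.log (ν : ℝ)⌋₊ + 1)).image fun k => Real.exp (-(k : ℝ))

/-- The bandwidth set `𝕄H = {h ∈ 𝓗 : (ln ν)²/ν ≤ h ≤ 1/ln(ln ν)}`. -/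
def MH (ν : ℕ) : Finset ℝ :=
  (Hgrid ν).filter fun h => Real.log (ν : ℝ) ^ 2 / (ν : ℝ) ≤ h ∧ h ≤ 1 / Real.log (Real.log (ν : ℝ))

/-- The sup-norm `‖K‖_∞`. -/
def supNorm (K : ℝ → ℝ) : ℝ := ⨆ u : ℝ, |K u|

/-- The `L₁`-norm `‖K‖₁`. -/
def L1norm (K : ℝ → ℝ) : ℝ := ∫ u, |K u|

/-- The squared `L₂`-norm `‖K‖₂²`. -/
def sqL2 (K : ℝ → ℝ) : ℝ := ∫ u, K u ^ 2

/-- The constant `α = 1 ∨ sup_{n ≥ 3} [(1 ∨ 𝔫(𝒬_{δ_n})) / ln n]`. -/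
def alphaConst (𝒬 : ℕ → Finset Mat2) : ℝ :=
  max 1
    (⨆ ν : {ν : ℕ // 3 ≤ ν},
      max 1 (Real.log (((𝒬 ν.1).card : ℝ))) / Real.log ((ν.1 : ℕ) : ℝ))

/-- The constant `A = 12√(10pα)(1+√(5p))(1 ∨ ‖K‖_∞) + 4C(K,𝔟,√2)`. -/
def Aconst (K : ℝ → ℝ) (b p a : ℝ) : ℝ :=
  12 * Real.sqrt (10 * p * a) * (1 + Real.sqrt (5 * p)) * max 1 (supNorm K) +
    4 * CK K b (Real.sqrt 2)

/-- The random quantity `Û_n`. -/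
def UhatI (K : ℝ → ℝ) (S : Finset Mat2) (x : V2) {n : ℕ} (I : Finset (Fin n))
    (ω : Fin n → V2) : ℝ :=
  ⨆ η ∈ MH I.card, ⨆ D ∈ S, ⨆ b ∈ ({mcol D 0, mcol D 1} : Set V2),
    max 1 (((I.card : ℝ)⁻¹ * ∑ k ∈ I, |Kh K η (b ⬝ᵥ (ω k - x))|) ^ 2)

/-- The quantity `R_n(Q,h)` of the adaptive selection rule. -/
def RnI (K : ℝ → ℝ) (A : ℝ) (S : Finset Mat2) (x : V2) {n : ℕ} (I : Finset (Fin n))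
    (Q : Mat2) (h : ℝ) (ω : Fin n → V2) : ℝ :=
  ⨆ η ∈ MH I.card, ⨆ η' ∈ MH I.card, ⨆ _ : η' ≤ η ∧ η ≤ h, ⨆ D ∈ S,
    max 0
      (|pairEstI K η D Q x I ω - prodEstI K η' D x I ω| -
        A * UhatI K S x I ω * Real.sqrt (Real.log (I.card : ℝ) / ((I.card : ℝ) * η')))

/-- The criterion `R_n(Q,h) + A Û_n √(ln n / (n h))` minimized by the adaptive
selection rule. -/
def crit (K : ℝ → ℝ) (A : ℝ) (S : Finset Mat2) (x : V2) {n : ℕ} (I : Finset (Fin n))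
    (Q : Mat2) (h : ℝ) (ω : Fin n → V2) : ℝ :=
  RnI K A S x I Q h ω +
    A * UhatI K S x I ω * Real.sqrt (Real.log (I.card : ℝ) / ((I.card : ℝ) * h))

/-- `κ_h(D,Q,x)`: the expectation of the auxiliary estimator if `D ≠ Q`, and the
product of the expectations of the two marginal estimators if `D = Q`. -/
def kappaI (K : ℝ → ℝ) (h : ℝ) (D Q : Mat2) (x : V2) (n : ℕ) (f : V2 → ℝ)
    (I : Finset (Fin n)) : ℝ :=
  if D = Q then
    (∫ ω, margEstI K h (mcol Q 0) x I ω ∂jointM n f) *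
      ∫ ω, margEstI K h (mcol Q 1) x I ω ∂jointM n f
  else ∫ ω, pairEstI K h D Q x I ω ∂jointM n f

/-- The random quantity `ζ_n(f,x)`. -/
def zeta (K : ℝ → ℝ) (a : ℝ) (S : Finset Mat2) (x : V2) (n : ℕ) (f : V2 → ℝ)
    (ω : Fin n → V2) : ℝ :=
  ⨆ h ∈ MH n, ⨆ D ∈ S, ⨆ Q ∈ S,
    max 0
      (|pairEstI K h D Q x Finset.univ ω - kappaI K h D Q x n f Finset.univ| -
        a * UhatI K S x Finset.univ ω * Real.sqrt (Real.log (n : ℝ) / ((n : ℝ) * h)))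

/-- The recursion `ℓ₀ = ln n`, `ℓ_{i+1} = ln ℓ_i`. -/
def lseq (n : ℕ) : ℕ → ℝ
  | 0 => Real.log n
  | i + 1 => Real.log (lseq n i)

/-- `ω₀ = ln n` and `ω_i = (ℓ_i ∨ 4) + 𝔫` for `i ≥ 1` where `m = 𝔫(𝒬_{δ_n})`. -/
def wseq (m : ℝ) (n : ℕ) : ℕ → ℝ
  | 0 => Real.log n
  | i + 1 => max (lseq n (i + 1)) 4 + m

/-- `i* = min {i ≥ 1 : ω_i = 4 + 𝔫}`. -/
def istar (m : ℝ) (n : ℕ) : ℕ := sInf {i : ℕ | 1 ≤ i ∧ wseq m n i = 4 + m}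

/-- `𝐧ᵢ = ⌊n ℓᵢ⁻¹⌋`. -/
def nbl (n i : ℕ) : ℕ := ⌊(n : ℝ) * (lseq n i)⁻¹⌋₊

/-- `Nᵢ = ⌊n/4⌋ + Σ_{j=1}^i 𝐧ⱼ`. -/
def Nbl (n i : ℕ) : ℕ := n / 4 + ∑ j ∈ Finset.Icc 1 i, nbl n j

/-- The size of the `i`-th data block. -/
def bsize (m : ℝ) (n i : ℕ) : ℕ :=
  if i = 0 then n / 4
  else if i = istar m n then n - Nbl n (istar m n - 1)
  else nbl n i

/-- The index set of the `i`-th data block `X^{(i)}`. -/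
def blockI (m : ℝ) (n i : ℕ) : Finset (Fin n) :=
  if i = 0 then Finset.univ.filter fun k => (k : ℕ) < n / 4
  else if i = istar m n then Finset.univ.filter fun k => Nbl n (istar m n - 1) ≤ (k : ℕ)
  else Finset.univ.filter fun k => Nbl n (i - 1) ≤ (k : ℕ) ∧ (k : ℕ) < Nbl n i

/-- The bandwidth `h_i = (L⁻⁴ ω_i / 𝐧_i)^{1/(2β+1)}`. -/
def hstep (β L m : ℝ) (n i : ℕ) : ℝ :=
  ((L ^ 4)⁻¹ * wseq m n i / (bsize m n i : ℝ)) ^ (1 / (2 * β + 1))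

/-- The constant `C(β)`. -/
def Cbeta (β : ℝ) : ℝ :=
  max 1
    (⨆ ν : {ν : ℕ // 3 ≤ ν},
      (Real.log ((ν.1 : ℕ) : ℝ) ^ 2 / ((ν.1 : ℕ) : ℝ)) ^ (2 * β / (2 * β + 1)) *
        Real.log ((ν.1 : ℕ) : ℝ) ^ (2 / (2 * β + 1)))

/-- The constant `B` of the minimax selection rule. -/
def Bconst (K : ℝ → ℝ) (p β L a : ℝ) : ℝ :=
  527730 * p ^ 2 * Real.sqrt 6 * max (max (L1norm K ^ 2) (sqL2 K)) (supNorm K ^ 2) *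
        (9 + 4 * a) ^ ((3 * β + 3) / (2 * β + 1)) * Cbeta β ^ ((3 : ℝ) / 2) *
        L ^ ((4 * β + 8) / (2 * β + 1)) +
    8 * CK K β (Real.sqrt 2) * L ^ 2

/-- The random quantity `χ_i(f,x)` (for a generic data block `I` and bandwidth `h`). -/
def chiI (K : ℝ → ℝ) (Cc β L : ℝ) (S : Finset Mat2) (x : V2) (n : ℕ) (f : V2 → ℝ)
    (I : Finset (Fin n)) (h : ℝ) (ω : Fin n → V2) : ℝ :=
  ⨆ D ∈ S, ⨆ Q ∈ S,
    max 0 (|pairEstI K h D Q x I ω - kappaI K h D Q x n f I| - Cc * L ^ 2 * h ^ β)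

/-- The quantity `R_n^{(i)}(Q)` of the minimax selection rule. -/
def Rblock (K : ℝ → ℝ) (B β L m : ℝ) (S : Finset Mat2) (x : V2) {n : ℕ} (i : ℕ)
    (Q : Mat2) (ω : Fin n → V2) : ℝ :=
  ⨆ D ∈ S,
    max 0
      (|pairEstI K (hstep β L m n i) D Q x (blockI m n i) ω -
          prodEstI K (hstep β L m n i) D x (blockI m n i) ω| -
        B * L ^ 2 * hstep β L m n i ^ β)

/-- `τ_f(D)` (for the representation `f = g(Q_fᵀ ∙)` and `fx = f(x)`). -/
def tau (g : V2 → ℝ) (Qf D : Mat2) (x : V2) (fx : ℝ) : ℝ :=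
  if D = Qf then fx
  else
    ∫ u : V2,
      g (p1 D Qf • (Γm *ᵥ u)) *
        g ((p1 D Qf)⁻¹ • ((D * Ωm) *ᵥ x) + p2 D Qf • ((Ωm * Γm) *ᵥ u))

/-- The centered Gaussian density with variance `σ2`. -/
def gauss (σ2 y : ℝ) : ℝ :=
  (Real.sqrt (2 * Real.pi * σ2))⁻¹ * Real.exp (-(y ^ 2) / (2 * σ2))

theorem holder_mono {β L L' : ℝ} {w : ℝ → ℝ} (hw : holder β L w) (h : L ≤ L') :
    holder β L' w :=
  ⟨hw.1, fun j hj y => (hw.2.1 j hj y).trans h, fun y z => (hw.2.2 y z).trans (by gcongr)⟩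

theorem holder_add {β L L' : ℝ} {u v : ℝ → ℝ} (hu : holder β L u) (hv : holder β L' v) :
    holder β (L + L') fun y => u y + v y := by
  have key : ∀ j : ℕ, j ≤ ⌈β⌉₊ - 1 → ∀ y, iteratedDeriv j (fun y => u y + v y) y =
      iteratedDeriv j u y + iteratedDeriv j v y := fun j hj y =>
    iteratedDeriv_fun_add (hu.1.contDiffAt.of_le (by exact_mod_cast hj))
      (hv.1.contDiffAt.of_le (by exact_mod_cast hj))
  refine ⟨hu.1.add hv.1, fun j hj y => ?_, fun y z => ?_⟩
  · rw [key j hj]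
    exact (abs_add_le _ _).trans (add_le_add (hu.2.1 j hj y) (hv.2.1 j hj y))
  · rw [key _ le_rfl, key _ le_rfl, add_sub_add_comm, add_mul]
    exact (abs_add_le _ _).trans (add_le_add (hu.2.2 y z) (hv.2.2 y z))

theorem holder_rescale {β L K b s : ℝ} {w : ℝ → ℝ} (hw : holder β L w) (hL : 0 ≤ L)
    (hs : 0 < s) (hb : 0 ≤ b) (hj : ∀ j : ℕ, j ≤ ⌈β⌉₊ - 1 → b * s ^ j ≤ K)
    (hK : b * s ^ β ≤ K) (t : ℝ) : holder β (K * L) fun y => b * w (s * y + t) := by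
  have hc : ContDiff ℝ ((⌈β⌉₊ - 1 : ℕ) : ℕ∞) fun y => w (y + t) :=
    hw.1.comp (contDiff_id.add contDiff_const)
  have key : ∀ j : ℕ, j ≤ ⌈β⌉₊ - 1 → ∀ y, iteratedDeriv j (fun y => b * w (s * y + t)) y =
      b * s ^ j * iteratedDeriv j w (s * y + t) := fun j hj y => by
    have := congrFun (iteratedDeriv_comp_const_mul
      (hc.of_le (show ((j : ℕ) : WithTop ℕ∞) ≤ _ by exact_mod_cast hj)) s) y
    rw [iteratedDeriv_comp_add_const] at this
    rw [iteratedDeriv_const_mul_field, this, mul_assoc]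
  refine ⟨contDiff_const.mul (hc.comp (contDiff_const.mul contDiff_id)), fun j hjr y => ?_,
    fun y z => ?_⟩
  · rw [key j hjr, abs_mul, abs_of_nonneg (by positivity)]
    exact mul_le_mul (hj j hjr) (hw.2.1 j hjr _) (abs_nonneg _)
      ((by positivity : 0 ≤ b * s ^ j).trans (hj j hjr))
  · rw [key _ le_rfl, key _ le_rfl, ← mul_sub, abs_mul, abs_of_nonneg (by positivity)]
    have h := hw.2.2 (s * y + t) (s * z)
    rw [abs_mul, abs_of_pos hs, Real.mul_rpow hs.le (abs_nonneg z),
      show s * y + t + s * z = s * (y + z) + t by ring] at h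
    calc _ ≤ b * s ^ (⌈β⌉₊ - 1) * (L * (s ^ (β - ((⌈β⌉₊ - 1 : ℕ) : ℝ)) *
          |z| ^ (β - ((⌈β⌉₊ - 1 : ℕ) : ℝ)))) := by gcongr
      _ = b * (s ^ (((⌈β⌉₊ - 1 : ℕ) : ℝ) + (β - ((⌈β⌉₊ - 1 : ℕ) : ℝ)))) *
          (L * |z| ^ (β - ((⌈β⌉₊ - 1 : ℕ) : ℝ))) := by
        rw [Real.rpow_add hs, Real.rpow_natCast]; ring
      _ = b * s ^ β * (L * |z| ^ (β - ((⌈β⌉₊ - 1 : ℕ) : ℝ))) := by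
        rw [add_sub_cancel]
      _ ≤ K * (L * |z| ^ (β - ((⌈β⌉₊ - 1 : ℕ) : ℝ))) := by gcongr
      _ = _ := by ring

/-- The order `⌈β⌉ - 1` of the top derivative lies strictly below `β`, by at most one. -/
theorem ceil_sub_one_lt_and_le {β : ℝ} (hβ : 0 < β) :
    ((⌈β⌉₊ - 1 : ℕ) : ℝ) < β ∧ β ≤ ((⌈β⌉₊ - 1 : ℕ) : ℝ) + 1 := by
  have h1 : 1 ≤ ⌈β⌉₊ := Nat.one_le_iff_ne_zero.2 (Nat.ceil_pos.2 hβ).ne'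
  have h2 := Nat.ceil_lt_add_one hβ.le
  have h3 := Nat.le_ceil β
  push_cast [Nat.cast_sub h1]
  constructor <;> linarith

theorem exists_holder_of_hasCompactSupport {β : ℝ} (hβ : 0 < β) {w : ℝ → ℝ}
    (hw : ContDiff ℝ ((⊤ : ℕ∞) : WithTop ℕ∞) w) (hc : HasCompactSupport w) :
    ∃ C : ℝ, 0 < C ∧ holder β C w := by
  have hbd : ∀ j : ℕ, ∃ C : ℝ, ∀ y, |iteratedDeriv j w y| ≤ C := fun j => by
    obtain ⟨C, hC⟩ := (hw.continuous_iteratedFDeriv (m := j)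
      (by exact_mod_cast le_top)).bounded_above_of_compact_support (hc.iteratedFDeriv (𝕜 := ℝ) j)
    exact ⟨C, fun y => by
      simpa [norm_iteratedFDeriv_eq_norm_iteratedDeriv] using hC y⟩
  choose C hC using hbd
  set D : ℝ := ∑ j ∈ Finset.range (⌈β⌉₊ + 1), |C j| with hD
  have hCD : ∀ j, j ≤ ⌈β⌉₊ → ∀ y, |iteratedDeriv j w y| ≤ D := fun j hj y =>
    ((hC j y).trans (le_abs_self _)).trans
      (Finset.single_le_sum (f := fun j => |C j|) (fun _ _ => abs_nonneg _)
        (Finset.mem_range.2 (by omega)))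
  have hD0 : 0 ≤ D := Finset.sum_nonneg fun _ _ => abs_nonneg _
  have h1 : ⌈β⌉₊ - 1 + 1 = ⌈β⌉₊ := by have := Nat.ceil_pos.2 hβ; omega
  refine ⟨2 * D + 1, by positivity, hw.of_le (by exact_mod_cast le_top),
    fun j hj y => (hCD j (by omega) y).trans (by linarith), fun y z => ?_⟩
  set r := ⌈β⌉₊ - 1 with hr
  obtain ⟨ha, hb⟩ := ceil_sub_one_lt_and_le hβ
  have hlip : |iteratedDeriv r w (y + z) - iteratedDeriv r w y| ≤ D * |z| := by
    have := Convex.norm_image_sub_le_of_norm_deriv_le (𝕜 := ℝ) (s := Set.univ) (C := D)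
      (f := iteratedDeriv r w) (x := y) (y := y + z)
      (fun x _ => (hw.differentiable_iteratedDeriv r
        (by exact_mod_cast WithTop.coe_lt_top r)) x)
      (fun x _ => by
        rw [← iteratedDeriv_succ]; exact hCD _ (by omega) x) convex_univ trivial trivial
    simpa using this
  rcases le_total |z| 1 with hz | hz
  · have : |z| ≤ |z| ^ (β - (r : ℝ)) := by
      rcases (abs_nonneg z).eq_or_lt with h0 | h0
      · rw [← h0]; positivity
      · exact Real.self_le_rpow_of_le_one h0.le hz (by linarith)
    calc _ ≤ D * |z| := hlip
      _ ≤ D * |z| ^ (β - (r : ℝ)) := by gcongr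
      _ ≤ _ := by gcongr; linarith
  · have : 1 ≤ |z| ^ (β - (r : ℝ)) := Real.one_le_rpow hz (by linarith)
    calc _ ≤ D + D := (abs_sub _ _).trans (add_le_add (hCD _ (by omega) _) (hCD _ (by omega) _))
      _ ≤ (2 * D + 1) * 1 := by linarith
      _ ≤ _ := by gcongr

/-- A quadratic lower bound for the minimum of `1` and `a`. -/
theorem two_mul_le_sq_mul_min_add_sq {M : ℝ} (hM : 2 ≤ M) (a : ℝ≥0∞) :
    ENNReal.ofReal (2 * M) * a ≤ ENNReal.ofReal (M ^ 2) * min 1 a + a ^ 2 := by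
  induction a with
  | top => simp
  | coe a =>
    rw [← ENNReal.ofReal_coe_nnreal, ← ENNReal.ofReal_one, ← ENNReal.ofReal_min,
      ← ENNReal.ofReal_mul (by positivity), ← ENNReal.ofReal_mul (by positivity),
      ← ENNReal.ofReal_pow a.coe_nonneg, ← ENNReal.ofReal_add (by positivity) (by positivity)]
    apply ENNReal.ofReal_le_ofReal
    have ha : (0 : ℝ) ≤ a := a.2
    rcases min_cases (1 : ℝ) a with ⟨h, _⟩ | ⟨h, _⟩ <;> rw [h]
    · nlinarith [sq_nonneg (M - a)]
    · nlinarith [mul_nonneg ha (mul_nonneg (by linarith : 0 ≤ M) (by linarith : 0 ≤ M - 2)),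
        sq_nonneg (a : ℝ)]

/-- If a likelihood ratio has second moment at most `M`, the affinity is at least `1 / M`. -/
theorem inv_le_lintegral_min_one {Ω : Type*} [MeasurableSpace Ω] (μ : Measure Ω)
    {ℓ : Ω → ℝ≥0∞} (hℓ : Measurable ℓ) {M : ℝ} (hM : 2 ≤ M) (h1 : ∫⁻ ω, ℓ ω ∂μ = 1)
    (h2 : ∫⁻ ω, ℓ ω ^ 2 ∂μ ≤ ENNReal.ofReal M) :
    ENNReal.ofReal (1 / M) ≤ ∫⁻ ω, min 1 (ℓ ω) ∂μ := by
  have hint := lintegral_mono (μ := μ) fun ω => two_mul_le_sq_mul_min_add_sq hM (ℓ ω)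
  rw [lintegral_const_mul _ hℓ, h1, mul_one, lintegral_add_right _ (by fun_prop),
    lintegral_const_mul _ (by fun_prop)] at hint
  have h3 : ENNReal.ofReal (2 * M) ≤
      ENNReal.ofReal (M ^ 2) * (∫⁻ ω, min 1 (ℓ ω) ∂μ) + ENNReal.ofReal M :=
    hint.trans (by gcongr)
  have hle1 : ∫⁻ ω, min 1 (ℓ ω) ∂μ ≠ ⊤ :=
    ((lintegral_mono fun ω => min_le_right 1 (ℓ ω)).trans_lt (by rw [h1]; simp)).ne
  generalize ∫⁻ ω, min 1 (ℓ ω) ∂μ = I at *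
  lift I to NNReal using hle1
  rw [← ENNReal.ofReal_coe_nnreal] at h3 ⊢
  rw [← ENNReal.ofReal_mul (by positivity), ← ENNReal.ofReal_add (by positivity) (by positivity),
    ENNReal.ofReal_le_ofReal_iff (by positivity)] at h3
  apply ENNReal.ofReal_le_ofReal
  rw [div_le_iff₀ (by positivity)]
  nlinarith

/-- Two-point lower bound for the sum of the absolute risks. -/
theorem two_point_lower_bound {Ω : Type*} [MeasurableSpace Ω] (μ : Measure Ω)
    {ℓ : Ω → ℝ≥0∞} (hℓ : Measurable ℓ) {M : ℝ} (hM : 2 ≤ M) (h1 : ∫⁻ ω, ℓ ω ∂μ = 1)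
    (h2 : ∫⁻ ω, ℓ ω ^ 2 ∂μ ≤ ENNReal.ofReal M) {T : Ω → ℝ} (hT : Measurable T) (a b : ℝ) :
    ENNReal.ofReal (|a - b| / M) ≤
      ∫⁻ ω, ENNReal.ofReal |T ω - a| ∂μ + ∫⁻ ω, ENNReal.ofReal |T ω - b| ∂μ.withDensity ℓ := by
  have hm : ∀ a : ℝ, Measurable fun ω => ENNReal.ofReal |T ω - a| := fun a =>
    (continuous_abs.measurable.comp (hT.sub_const a)).ennreal_ofReal
  rw [lintegral_withDensity_eq_lintegral_mul _ hℓ (hm b), ← lintegral_add_left (hm a)]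
  calc ENNReal.ofReal (|a - b| / M)
      = ENNReal.ofReal |a - b| * ENNReal.ofReal (1 / M) := by
        rw [← ENNReal.ofReal_mul (abs_nonneg _), mul_one_div]
    _ ≤ ENNReal.ofReal |a - b| * ∫⁻ ω, min 1 (ℓ ω) ∂μ := by
        gcongr; exact inv_le_lintegral_min_one μ hℓ hM h1 h2
    _ = ∫⁻ ω, ENNReal.ofReal |a - b| * min 1 (ℓ ω) ∂μ :=
        (lintegral_const_mul _ (by fun_prop)).symm
    _ ≤ _ := by
        refine lintegral_mono fun ω => ?_
        have habs : |a - b| ≤ |T ω - a| + |T ω - b| := by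
          rw [abs_sub_comm (T ω) a]; exact abs_sub_le a (T ω) b
        calc ENNReal.ofReal |a - b| * min 1 (ℓ ω)
            ≤ (ENNReal.ofReal |T ω - a| + ENNReal.ofReal |T ω - b|) * min 1 (ℓ ω) := by
              gcongr
              rw [← ENNReal.ofReal_add (abs_nonneg _) (abs_nonneg _)]
              exact ENNReal.ofReal_le_ofReal habs
          _ ≤ ENNReal.ofReal |T ω - a| * 1 + ENNReal.ofReal |T ω - b| * ℓ ω := by
              rw [add_mul]
              gcongr
              · exact min_le_left _ _
              · exact min_le_right _ _
          _ = _ := by simp [mul_comm]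

theorem lintegral_pi_prod {n : ℕ} {X : Type*} [MeasurableSpace X] (μ : Measure X)
    [IsProbabilityMeasure μ] (F : Fin n → X → ℝ≥0∞) (hF : ∀ i, Measurable (F i)) :
    ∫⁻ ω, ∏ i, F i (ω i) ∂(Measure.pi fun _ : Fin n => μ) = ∏ i, ∫⁻ y, F i y ∂μ := by
  refine (ProbabilityTheory.lintegral_prod_eq_prod_lintegral_of_indepFun Finset.univ
    (fun i (ω : Fin n → X) => F i (ω i))
    (ProbabilityTheory.iIndepFun_pi (μ := fun _ : Fin n => μ) fun i => (hF i).aemeasurable)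
    (fun i => (hF i).comp (measurable_pi_apply i))).trans ?_
  refine Finset.prod_congr rfl fun i _ => ?_
  exact (measurePreserving_eval (fun _ : Fin n => μ) i).lintegral_comp (hF i)

/-- The likelihood ratio of a product measure is the product of the likelihood ratios. -/
theorem pi_withDensity_eq {n : ℕ} {X : Type*} [MeasurableSpace X] (μ : Measure X)
    [IsProbabilityMeasure μ] {ρ : X → ℝ≥0∞} (hρ : Measurable ρ)
    [IsProbabilityMeasure (μ.withDensity ρ)] :
    Measure.pi (fun _ : Fin n => μ.withDensity ρ) =
      (Measure.pi fun _ : Fin n => μ).withDensity fun ω => ∏ i, ρ (ω i) := by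
  refine Measure.pi_eq fun s hs => ?_
  rw [withDensity_apply _ (MeasurableSet.univ_pi hs),
    ← lintegral_indicator (MeasurableSet.univ_pi hs)]
  calc _ = ∫⁻ ω, ∏ i, (s i).indicator ρ (ω i) ∂(Measure.pi fun _ : Fin n => μ) := by
        refine lintegral_congr fun ω => ?_
        by_cases h : ω ∈ Set.univ.pi s
        · rw [Set.indicator_of_mem h]
          exact Finset.prod_congr rfl fun i _ =>
            (Set.indicator_of_mem (h i trivial) ρ).symm
        · rw [Set.indicator_of_notMem h]
          simp only [Set.mem_pi, Set.mem_univ, true_implies, not_forall] at h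
          obtain ⟨i, hi⟩ := h
          exact (Finset.prod_eq_zero (Finset.mem_univ i) (Set.indicator_of_notMem hi ρ)).symm
    _ = _ := by
        rw [lintegral_pi_prod μ _ fun i => hρ.indicator (hs i)]
        exact Finset.prod_congr rfl fun i _ => by
          rw [lintegral_indicator (hs i), withDensity_apply _ (hs i)]

theorem lintegral_le_rpow_lintegral {Ω : Type*} [MeasurableSpace Ω] (μ : Measure Ω)
    [IsProbabilityMeasure μ] {p : ℝ} (hp : 1 ≤ p) {F : Ω → ℝ≥0∞} (hF : Measurable F) :
    ∫⁻ ω, F ω ∂μ ≤ (∫⁻ ω, F ω ^ p ∂μ) ^ (1 / p) := by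
  have := eLpNorm'_le_eLpNorm'_of_exponent_le (f := F) (p := 1) (q := p) zero_lt_one hp μ
    hF.aestronglyMeasurable
  simpa [eLpNorm'] using this

theorem IsRotation.det_transpose {Q : Mat2} (hQ : IsRotation Q) : Qᵀ.det = 1 := by
  obtain ⟨h1, h2, h3⟩ := hQ
  rw [Matrix.det_transpose, Matrix.det_fin_two, h2, ← h1]
  linarith

theorem IsRotation.measurePreserving {Q : Mat2} (hQ : IsRotation Q) :
    MeasurePreserving (fun v : V2 => Qᵀ *ᵥ v) volume volume := by
  refine ⟨by fun_prop, ?_⟩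
  have := Real.map_matrix_volume_pi_eq_smul_volume_pi (M := Qᵀ) (by simp [hQ.det_transpose])
  rw [hQ.det_transpose, inv_one, abs_one, ENNReal.ofReal_one, one_smul] at this
  exact this

theorem lintegral_rotated_mul {Q : Mat2} (hQ : IsRotation Q) {F G : ℝ → ℝ≥0∞}
    (hF : Measurable F) (hG : Measurable G) :
    ∫⁻ v : V2, F ((Qᵀ *ᵥ v) 0) * G ((Qᵀ *ᵥ v) 1) = (∫⁻ y, F y) * ∫⁻ y, G y := by
  have hm : Measurable fun v : V2 => F (v 0) * G (v 1) := by fun_prop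
  have hm2 : Measurable fun z : ℝ × ℝ => F z.1 * G z.2 := by fun_prop
  rw [hQ.measurePreserving.lintegral_comp hm]
  refine ((volume_preserving_finTwoArrow ℝ).lintegral_comp hm2).trans ?_
  exact lintegral_prod_mul hF.aemeasurable hG.aemeasurable

/-- The density with independent factors `u`, `v` in the coordinates rotated by `Q`. -/
def rotatedProduct (Q : Mat2) (u v : ℝ → ℝ) : V2 → ℝ :=
  fun y => u ((Qᵀ *ᵥ y) 0) * v ((Qᵀ *ᵥ y) 1)

/-- A continuous nonnegative function integrating to one. -/
structure IsContDensity (u : ℝ → ℝ) : Prop where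
  continuous : Continuous u
  nonneg : ∀ y, 0 ≤ u y
  integral_eq_one : ∫ y, u y = 1

theorem IsContDensity.integrable {u : ℝ → ℝ} (hu : IsContDensity u) : Integrable u :=
  integrable_of_integral_eq_one hu.integral_eq_one

theorem IsContDensity.lintegral {u : ℝ → ℝ} (hu : IsContDensity u) :
    ∫⁻ y, ENNReal.ofReal (u y) = 1 := by
  rw [← ofReal_integral_eq_lintegral_ofReal hu.integrable (ae_of_all _ hu.nonneg),
    hu.integral_eq_one, ENNReal.ofReal_one]

theorem measurable_rotatedProduct (Q : Mat2) {u v : ℝ → ℝ} (hu : Continuous u)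
    (hv : Continuous v) : Measurable (rotatedProduct Q u v) := by
  have h : Measurable fun y : V2 => Qᵀ *ᵥ y := by fun_prop
  exact (hu.measurable.comp ((measurable_pi_apply 0).comp h)).mul
    (hv.measurable.comp ((measurable_pi_apply 1).comp h))

theorem isProbabilityMeasure_densM {Q : Mat2} (hQ : IsRotation Q) {u v : ℝ → ℝ}
    (hu : IsContDensity u) (hv : IsContDensity v) :
    IsProbabilityMeasure (densM (rotatedProduct Q u v)) := by
  constructor
  rw [densM, withDensity_apply _ MeasurableSet.univ, Measure.restrict_univ]
  simp only [rotatedProduct, ENNReal.ofReal_mul (hu.nonneg _)]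
  rw [lintegral_rotated_mul hQ hu.continuous.measurable.ennreal_ofReal
    hv.continuous.measurable.ennreal_ofReal, hu.lintegral, hv.lintegral, one_mul]

theorem risk_ge_lintegral {p : ℝ} (hp : 1 ≤ p) {n : ℕ} {x : V2} {f : V2 → ℝ}
    [IsProbabilityMeasure (densM f)] {T : (Fin n → V2) → ℝ} (hT : Measurable T) :
    ∫⁻ ω, ENNReal.ofReal |T ω - f x| ∂jointM n f ≤ risk p n x f T := by
  unfold risk jointM
  exact lintegral_le_rpow_lintegral _ hp
    (continuous_abs.measurable.comp (hT.sub_const _)).ennreal_ofReal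

section Perturbation

variable {Q : Mat2} {g P : ℝ → ℝ} {m : ℝ}

theorem add_eq_mul_of_eqOn_support (hm : 0 < m) (hgm : ∀ y, P y ≠ 0 → g y = m) (y : ℝ) :
    g y + P y = g y * (1 + P y / m) := by
  by_cases h : P y = 0
  · simp [h]
  · rw [hgm y h]; field_simp

theorem densM_perturb (hg : IsContDensity g) (hP : Continuous P) (hm : 0 < m)
    (hgm : ∀ y, P y ≠ 0 → g y = m) :
    densM (rotatedProduct Q (fun y => g y + P y) g) =
      (densM (rotatedProduct Q g g)).withDensity
        fun v => ENNReal.ofReal (1 + P ((Qᵀ *ᵥ v) 0) / m) := by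
  have h : Measurable fun y : V2 => Qᵀ *ᵥ y := by fun_prop
  have hP' : Measurable fun y : V2 => P ((Qᵀ *ᵥ y) 0) :=
    hP.measurable.comp ((measurable_pi_apply 0).comp h)
  unfold densM
  rw [← withDensity_mul _
    (measurable_rotatedProduct Q hg.continuous hg.continuous).ennreal_ofReal (by fun_prop)]
  congr 1
  funext v
  simp only [Pi.mul_apply, rotatedProduct]
  rw [← ENNReal.ofReal_mul (mul_nonneg (hg.nonneg _) (hg.nonneg _)),
    add_eq_mul_of_eqOn_support hm hgm]
  ring_nf

theorem lintegral_ratio_sq (hQ : IsRotation Q) (hg : IsContDensity g) (hP : Continuous P)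
    (hPi : Integrable P) (hP2 : Integrable fun y => P y ^ 2) (hP0 : ∫ y, P y = 0)
    (hm : 0 < m) (hPm : ∀ y, |P y| ≤ m) (hgm : ∀ y, P y ≠ 0 → g y = m) :
    ∫⁻ v, ENNReal.ofReal (1 + P ((Qᵀ *ᵥ v) 0) / m) ^ 2 ∂densM (rotatedProduct Q g g) =
      ENNReal.ofReal (1 + (∫ y, P y ^ 2) / m) := by
  have hρ : ∀ y, 0 ≤ 1 + P y / m := fun y => by
    have := (abs_le.1 (hPm y)).1
    have : -1 ≤ P y / m := by rw [le_div_iff₀ hm]; linarith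
    linarith
  have h : Measurable fun y : V2 => Qᵀ *ᵥ y := by fun_prop
  have hP' : Measurable fun y : V2 => P ((Qᵀ *ᵥ y) 0) :=
    hP.measurable.comp ((measurable_pi_apply 0).comp h)
  have hPmeas := hP.measurable
  have hgmeas := hg.continuous.measurable
  have hsq : ∀ y, g y * (1 + P y / m) ^ 2 = g y + 2 * P y + P y ^ 2 / m := fun y => by
    by_cases h : P y = 0
    · simp [h]
    · rw [hgm y h]; field_simp; ring
  unfold densM
  rw [lintegral_withDensity_eq_lintegral_mul _
    (measurable_rotatedProduct Q hg.continuous hg.continuous).ennreal_ofReal (by fun_prop)]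
  have hi₁ : Integrable fun y => g y + 2 * P y := hg.integrable.add (hPi.const_mul 2)
  have hi : Integrable fun y => g y + 2 * P y + P y ^ 2 / m := hi₁.add (hP2.div_const m)
  calc _ = ∫⁻ v : V2, (fun y => ENNReal.ofReal (g y + 2 * P y + P y ^ 2 / m)) ((Qᵀ *ᵥ v) 0) *
        (fun y => ENNReal.ofReal (g y)) ((Qᵀ *ᵥ v) 1) := by
        refine lintegral_congr fun v => ?_
        simp only [Pi.mul_apply, rotatedProduct]
        rw [← ENNReal.ofReal_pow (hρ _),
          ← ENNReal.ofReal_mul (mul_nonneg (hg.nonneg _) (hg.nonneg _)),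
          ← ENNReal.ofReal_mul (by rw [← hsq]; exact mul_nonneg (hg.nonneg _) (sq_nonneg _)),
          ← hsq]
        ring_nf
    _ = ∫⁻ y, ENNReal.ofReal (g y + 2 * P y + P y ^ 2 / m) := by
        exact (lintegral_rotated_mul hQ (F := fun y => ENNReal.ofReal (g y + 2 * P y + P y ^ 2 / m))
          (G := fun y => ENNReal.ofReal (g y)) (by fun_prop) (by fun_prop)).trans
          (by rw [hg.lintegral, mul_one])
    _ = ENNReal.ofReal (∫ y, (g y + 2 * P y + P y ^ 2 / m)) := by
        rw [ofReal_integral_eq_lintegral_ofReal hi]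
        exact ae_of_all _ fun y => by
          simp only [Pi.zero_apply]
          rw [← hsq]; exact mul_nonneg (hg.nonneg _) (sq_nonneg _)
    _ = _ := by
        rw [integral_add hi₁ (hP2.div_const m),
          integral_add hg.integrable (hPi.const_mul 2), integral_const_mul, integral_div,
          hP0, hg.integral_eq_one]
        ring_nf

theorem isContDensity_perturb (hg : IsContDensity g) (hP : Continuous P)
    (hPi : Integrable P) (hP0 : ∫ y, P y = 0) (hPm : ∀ y, |P y| ≤ m)
    (hgm : ∀ y, P y ≠ 0 → g y = m) : IsContDensity fun y => g y + P y where
  continuous := hg.continuous.add hP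
  nonneg y := by
    by_cases h : P y = 0
    · simpa [h] using hg.nonneg y
    · rw [hgm y h]; linarith [(abs_le.1 (hPm y)).1]
  integral_eq_one := by
    rw [integral_add hg.integrable hPi, hP0, hg.integral_eq_one, add_zero]

/-- Two-point lower bound for the product densities with first factors `g` and `g + P`. -/
theorem risk_add_risk_ge {p : ℝ} (hp : 1 ≤ p) (hQ : IsRotation Q) (hg : IsContDensity g)
    (hP : Continuous P) (hPi : Integrable P) (hP2 : Integrable fun y => P y ^ 2)
    (hP0 : ∫ y, P y = 0) (hm : 0 < m) (hPm : ∀ y, |P y| ≤ m)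
    (hgm : ∀ y, P y ≠ 0 → g y = m) {n : ℕ} (hn : 1 ≤ n) {D : ℝ} (hD : 0 ≤ D)
    (hPD : (∫ y, P y ^ 2) / m ≤ D / n) (x : V2) {T : (Fin n → V2) → ℝ} (hT : Measurable T) :
    ENNReal.ofReal (|P ((Qᵀ *ᵥ x) 0) * g ((Qᵀ *ᵥ x) 1)| / (Real.exp D + 1)) ≤
      risk p n x (rotatedProduct Q g g) T +
        risk p n x (rotatedProduct Q (fun y => g y + P y) g) T := by
  have hg' := isContDensity_perturb hg hP hPi hP0 hPm hgm
  have i0 := isProbabilityMeasure_densM hQ hg hg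
  have i1 := isProbabilityMeasure_densM hQ hg' hg
  refine le_trans ?_ (add_le_add (risk_ge_lintegral hp hT) (risk_ge_lintegral hp hT))
  have h : Measurable fun y : V2 => Qᵀ *ᵥ y := by fun_prop
  have hP' : Measurable fun y : V2 => P ((Qᵀ *ᵥ y) 0) :=
    hP.measurable.comp ((measurable_pi_apply 0).comp h)
  have hd := densM_perturb (Q := Q) hg hP hm hgm
  set ρ : V2 → ℝ≥0∞ := fun v => ENNReal.ofReal (1 + P ((Qᵀ *ᵥ v) 0) / m) with hρdef
  have hρ : Measurable ρ := by fun_prop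
  have i1' := i1
  rw [hd] at i1'
  have hj : jointM n (rotatedProduct Q (fun y => g y + P y) g) =
      (jointM n (rotatedProduct Q g g)).withDensity fun ω => ∏ i, ρ (ω i) := by
    unfold jointM
    simp only [hd]
    exact pi_withDensity_eq _ hρ
  have hρ1 : ∫⁻ v, ρ v ∂densM (rotatedProduct Q g g) = 1 := by
    rw [← setLIntegral_univ, ← withDensity_apply _ MeasurableSet.univ]
    exact i1'.measure_univ
  have hn0 : (0 : ℝ) < n := by exact_mod_cast hn
  have key := two_point_lower_bound (jointM n (rotatedProduct Q g g))
    (ℓ := fun ω => ∏ i, ρ (ω i)) (by fun_prop) (M := Real.exp D + 1)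
    (by linarith [Real.one_le_exp hD])
    (by unfold jointM; rw [lintegral_pi_prod _ _ fun _ => hρ]; simp [hρ1])
    (by
      unfold jointM
      simp only [← Finset.prod_pow]
      rw [lintegral_pi_prod _ (fun _ v => ρ v ^ 2) fun _ => by fun_prop]
      simp only [hρdef, lintegral_ratio_sq hQ hg hP hPi hP2 hP0 hm hPm hgm, Finset.prod_const,
        Finset.card_univ, Fintype.card_fin]
      have hnn : 0 ≤ (∫ y, P y ^ 2) / m :=
        div_nonneg (integral_nonneg fun _ => sq_nonneg _) hm.le
      rw [← ENNReal.ofReal_pow (by positivity)]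
      apply ENNReal.ofReal_le_ofReal
      calc (1 + (∫ y, P y ^ 2) / m) ^ n ≤ Real.exp (D / n) ^ n := by
            gcongr
            linarith [Real.add_one_le_exp (D / n)]
        _ = Real.exp D := by rw [← Real.exp_nat_mul]; congr 1; field_simp
        _ ≤ _ := by linarith)
    hT (rotatedProduct Q g g x) (rotatedProduct Q (fun y => g y + P y) g x)
  rw [hj]
  refine le_trans (le_of_eq ?_) key
  congr 2
  simp only [rotatedProduct]
  rw [abs_sub_comm]
  ring_nf

end Perturbation

/-- A smooth even plateau function: one on `[-1, 1]`, zero outside `(-2, 2)`. -/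
def plateau : ContDiffBump (0 : ℝ) := ⟨1, 2, one_pos, one_lt_two⟩

theorem plateau_eq_one {y : ℝ} (hy : |y| ≤ 1) : plateau y = 1 :=
  plateau.one_of_mem_closedBall (by simpa [plateau] using hy)

theorem plateau_eq_zero {y : ℝ} (hy : 2 ≤ |y|) : plateau y = 0 :=
  plateau.zero_of_le_dist (by simpa [plateau] using hy)

theorem integral_plateau_pos : 0 < ∫ y, plateau y := plateau.integral_pos

theorem integral_comp_affine (w : ℝ → ℝ) {s : ℝ} (hs : 0 < s) (t : ℝ) :
    ∫ y, w (s * y + t) = s⁻¹ * ∫ y, w y := by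
  rw [Measure.integral_comp_mul_left (fun y => w (y + t)) s, abs_of_pos (inv_pos.2 hs),
    smul_eq_mul, integral_add_right_eq_self]

theorem integrable_comp_affine {w : ℝ → ℝ} (hw : Integrable w) {s : ℝ} (hs : 0 < s) (t : ℝ) :
    Integrable fun y => w (s * y + t) :=
  (hw.comp_add_right t).comp_mul_left' hs.ne'

/-- A smooth, even, compactly supported function of mean zero with value one at the origin. -/
def wavelet (y : ℝ) : ℝ := 2 * plateau (2 * y) - plateau y

theorem wavelet_contDiff : ContDiff ℝ ((⊤ : ℕ∞) : WithTop ℕ∞) wavelet :=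
  (contDiff_const.mul (plateau.contDiff.comp (contDiff_const.mul contDiff_id))).sub
    plateau.contDiff

theorem wavelet_neg (y : ℝ) : wavelet (-y) = wavelet y := by
  simp only [wavelet, mul_neg, plateau.neg]

theorem wavelet_zero : wavelet 0 = 1 := by
  simp only [wavelet, mul_zero, plateau_eq_one (y := 0) (by simp)]; norm_num

theorem wavelet_eq_zero {y : ℝ} (hy : 2 ≤ |y|) : wavelet y = 0 := by
  rw [wavelet, plateau_eq_zero hy, plateau_eq_zero (by rw [abs_mul, abs_two]; linarith)]
  norm_num

theorem abs_wavelet_le (y : ℝ) : |wavelet y| ≤ 2 := by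
  have := plateau.nonneg' y
  have := plateau.nonneg' (2 * y)
  have := plateau.le_one (x := y)
  have := plateau.le_one (x := 2 * y)
  rw [wavelet, abs_le]
  constructor <;> linarith

theorem wavelet_hasCompactSupport : HasCompactSupport wavelet :=
  HasCompactSupport.intro (isCompact_closedBall (0 : ℝ) 2) fun y hy =>
    wavelet_eq_zero (by
      rw [Metric.mem_closedBall, dist_zero_right, Real.norm_eq_abs, not_le] at hy; exact hy.le)

theorem integrable_wavelet : Integrable wavelet :=
  wavelet_contDiff.continuous.integrable_of_hasCompactSupport wavelet_hasCompactSupport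

theorem integrable_wavelet_sq : Integrable fun y => wavelet y ^ 2 := by
  simp only [pow_two]
  exact integrable_wavelet.bdd_mul (c := 2) wavelet_contDiff.continuous.aestronglyMeasurable
    (ae_of_all _ abs_wavelet_le)

theorem integral_wavelet : ∫ y, wavelet y = 0 := by
  have h2 : Integrable fun y : ℝ => plateau (2 * y) :=
    plateau.integrable.comp_mul_left' two_ne_zero
  have h := integral_comp_affine (fun y => plateau y) two_pos 0
  simp only [add_zero] at h
  unfold wavelet
  rw [integral_sub (h2.const_mul 2) plateau.integrable, integral_const_mul, h]
  ring

/-- The symmetric pair of rescaled wavelets with amplitude `b`, scale `s⁻¹` and centres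
`± t / s`. -/
def waveletPair (b s t y : ℝ) : ℝ := b * wavelet (s * y + t) + b * wavelet (s * y + -t)

section WaveletPair

variable {b s : ℝ} (t : ℝ)

theorem waveletPair_continuous : Continuous (waveletPair b s t) := by
  have := wavelet_contDiff.continuous
  unfold waveletPair
  fun_prop

theorem waveletPair_neg (y : ℝ) : waveletPair b s t (-y) = waveletPair b s t y := by
  unfold waveletPair
  rw [← wavelet_neg, ← wavelet_neg (s * -y + -t), add_comm]
  ring_nf

theorem abs_waveletPair_le (hb : 0 ≤ b) (y : ℝ) : |waveletPair b s t y| ≤ 4 * b := by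
  unfold waveletPair
  rw [← mul_add, abs_mul, abs_of_nonneg hb]
  have := (abs_add_le (wavelet (s * y + t)) (wavelet (s * y + -t))).trans
    (add_le_add (abs_wavelet_le _) (abs_wavelet_le _))
  nlinarith

theorem integrable_waveletPair (hs : 0 < s) : Integrable (waveletPair b s t) :=
  ((integrable_comp_affine integrable_wavelet hs t).const_mul b).add
    ((integrable_comp_affine integrable_wavelet hs (-t)).const_mul b)

theorem integral_waveletPair (hs : 0 < s) : ∫ y, waveletPair b s t y = 0 := by
  unfold waveletPair
  rw [integral_add ((integrable_comp_affine integrable_wavelet hs t).const_mul b)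
    ((integrable_comp_affine integrable_wavelet hs (-t)).const_mul b), integral_const_mul,
    integral_const_mul, integral_comp_affine _ hs, integral_comp_affine _ hs, integral_wavelet]
  simp

theorem integrable_waveletPair_sq (hb : 0 ≤ b) (hs : 0 < s) :
    Integrable fun y => waveletPair b s t y ^ 2 := by
  simp only [pow_two]
  exact (integrable_waveletPair t hs).bdd_mul (c := 4 * b)
    (waveletPair_continuous t).aestronglyMeasurable
    (ae_of_all _ fun y => abs_waveletPair_le t hb y)

theorem integral_waveletPair_sq_le (hb : 0 ≤ b) (hs : 0 < s) :
    ∫ y, waveletPair b s t y ^ 2 ≤ 4 * b ^ 2 * s⁻¹ * ∫ y, wavelet y ^ 2 := by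
  have h1 := (integrable_comp_affine integrable_wavelet_sq hs t).const_mul (2 * b ^ 2)
  have h2 := (integrable_comp_affine integrable_wavelet_sq hs (-t)).const_mul (2 * b ^ 2)
  calc _ ≤ ∫ y, (2 * b ^ 2 * wavelet (s * y + t) ^ 2 + 2 * b ^ 2 * wavelet (s * y + -t) ^ 2) := by
        refine integral_mono (integrable_waveletPair_sq t hb hs) (h1.add h2) fun y => ?_
        simp only [waveletPair]
        nlinarith [sq_nonneg (b * wavelet (s * y + t) - b * wavelet (s * y + -t))]
    _ = _ := by
        rw [integral_add h1 h2, integral_const_mul, integral_const_mul,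
          integral_comp_affine (fun y => wavelet y ^ 2) hs,
          integral_comp_affine (fun y => wavelet y ^ 2) hs]
        ring

theorem abs_le_of_waveletPair_ne_zero (hs : 0 < s) {y : ℝ} (hy : waveletPair b s t y ≠ 0) :
    |y| ≤ (|t| + 2) / s := by
  by_contra! hlt
  rw [div_lt_iff₀ hs] at hlt
  have habs : |s * y| = |y| * s := by rw [abs_mul, abs_of_pos hs, mul_comm]
  have h1 := abs_sub_abs_le_abs_sub (s * y) (-t)
  have h2 := abs_sub_abs_le_abs_sub (s * y) t
  rw [abs_neg, sub_neg_eq_add] at h1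
  rw [sub_eq_add_neg (s * y)] at h2
  apply hy
  rw [waveletPair, wavelet_eq_zero (by linarith), wavelet_eq_zero (by linarith)]
  simp

theorem le_waveletPair_centre (hb : 0 ≤ b) (hs : 0 < s) {v : ℝ} (hv : v = 0 ∨ 1 ≤ s * |v|) :
    b ≤ waveletPair b s (s * v) v := by
  unfold waveletPair
  rw [add_neg_cancel, wavelet_zero]
  rcases hv with rfl | hv
  · simp only [mul_zero, add_zero, wavelet_zero]; linarith
  · rw [wavelet_eq_zero (by rw [← two_mul, abs_mul, abs_mul, abs_two, abs_of_pos hs]; linarith)]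
    linarith

end WaveletPair

theorem memF_rotatedProduct {β L : ℝ} {Q : Mat2} (hQ : IsRotation Q) {u v : ℝ → ℝ}
    (hu : IsContDensity u) (hv : IsContDensity v) (hu' : holder β L u) (hv' : holder β L v)
    (hus : ∀ y, u (-y) = u y) (hvs : ∀ y, v (-y) = v y) :
    memF β L {Q} (rotatedProduct Q u v) :=
  ⟨fun y => u (y 0) * v (y 1), ⟨u, v, hu', hv', hu.nonneg, hv.nonneg, hus, hvs,
    hu.integral_eq_one, hv.integral_eq_one, fun _ => rfl⟩, Q, rfl, hQ, fun _ => rfl⟩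

/-- There are arbitrarily flat symmetric densities in the Hölder class. -/
theorem exists_flat_density {β L : ℝ} (hβ : 0 < β) (hL : 0 < L) (R : ℝ) :
    ∃ (g : ℝ → ℝ) (m : ℝ), 0 < m ∧ IsContDensity g ∧ holder β L g ∧ (∀ y, g (-y) = g y) ∧
      ∀ y, |y| ≤ R → g y = m := by
  obtain ⟨C, hC, hCh⟩ := exists_holder_of_hasCompactSupport (w := fun y => plateau y) hβ
    plateau.contDiff plateau.hasCompactSupport
  have hI := integral_plateau_pos
  set I := ∫ y, plateau y with hIdef
  set σ := max (max 1 R) (C / (I * L)) with hσ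
  have hσ1 : 1 ≤ σ := (le_max_left 1 R).trans (le_max_left _ _)
  have hσR : R ≤ σ := (le_max_right 1 R).trans (le_max_left _ _)
  have hσ0 : 0 < σ := by linarith
  have hσC : C / (I * L) ≤ σ := le_max_right _ _
  have hs : 0 < σ⁻¹ := inv_pos.2 hσ0
  have hs1 : σ⁻¹ ≤ 1 := inv_le_one_of_one_le₀ hσ1
  have hm : 0 < σ⁻¹ / I := by positivity
  refine ⟨fun y => σ⁻¹ / I * plateau (σ⁻¹ * y + 0), σ⁻¹ / I, hm, ⟨?_, ?_, ?_⟩, ?_, ?_, ?_⟩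
  · have := plateau.continuous
    fun_prop
  · exact fun y => mul_nonneg hm.le (plateau.nonneg' _)
  · rw [integral_const_mul, integral_comp_affine (fun y => plateau y) hs]
    field_simp
    exact hIdef.symm
  · refine holder_mono (holder_rescale hCh hC.le hs hm.le (K := σ⁻¹ / I) (fun j _ => ?_) ?_ 0) ?_
    · exact mul_le_of_le_one_right hm.le (pow_le_one₀ hs.le hs1)
    · exact mul_le_of_le_one_right hm.le (Real.rpow_le_one hs.le hs1 hβ.le)
    · rw [div_le_iff₀ (by positivity)] at hσC
      rw [inv_eq_one_div, div_div, div_mul_eq_mul_div, one_mul, div_le_iff₀ (by positivity)]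
      linarith
  · intro y
    simp only [add_zero, mul_neg, plateau.neg]
  · intro y hy
    simp only [add_zero]
    rw [plateau_eq_one, mul_one]
    rw [abs_mul, abs_of_pos hs, inv_mul_le_iff₀ hσ0]
    linarith

theorem holder_waveletPair {β C A h : ℝ} (hβ : 0 < β) (hC : holder β C wavelet) (hC0 : 0 ≤ C)
    (hA : 0 ≤ A) (hh : 0 < h) (hh1 : h ≤ 1) (t : ℝ) :
    holder β (A * C + A * C) (waveletPair (A * h ^ β) h⁻¹ t) := by
  have hb : 0 ≤ A * h ^ β := by positivity
  have hj : ∀ j : ℕ, j ≤ ⌈β⌉₊ - 1 → A * h ^ β * h⁻¹ ^ j ≤ A := fun j hj => by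
    have hjβ : (j : ℝ) ≤ β :=
      (Nat.cast_le.2 hj).trans (ceil_sub_one_lt_and_le hβ).1.le
    rw [mul_assoc, inv_pow, ← Real.rpow_natCast, ← div_eq_mul_inv]
    exact mul_le_of_le_one_right hA
      ((div_le_one (by positivity)).2 (Real.rpow_le_rpow_of_exponent_ge hh hh1 hjβ))
  have hK : A * h ^ β * h⁻¹ ^ β ≤ A := by
    rw [mul_assoc, Real.inv_rpow hh.le, mul_inv_cancel₀ (by positivity), mul_one]
  exact holder_add (holder_rescale hC hC0 (inv_pos.2 hh) hb hj hK t)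
    (holder_rescale hC hC0 (inv_pos.2 hh) hb hj hK (-t))


/-- Theorem 1, lower bound: for known rotation `Q`, no estimator can
beat the rate `n^{-β/(2β+1)}` uniformly over `F(β,L,{Q})`. -/
theorem statement1 (β L p : ℝ) (hβ : 0 < β) (hL : 0 < L) (hp : 1 ≤ p)
    (Q : Mat2) (hQ : IsRotation Q) (x : V2) :
    ∃ c : ℝ, 0 < c ∧
      ∀ n : ℕ, 1 ≤ n → ∀ T : (Fin n → V2) → ℝ, Measurable T →
        ENNReal.ofReal (c * (n : ℝ) ^ (-(β / (2 * β + 1)))) ≤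
          ⨆ f ∈ {f : V2 → ℝ | memF β L {Q} f}, risk p n x f T := by
  set v₀ := (Qᵀ *ᵥ x) 0 with hv₀
  set v₁ := (Qᵀ *ᵥ x) 1 with hv₁
  obtain ⟨g, m, hm, hg, hgL, hgs, hgm⟩ :=
    exists_flat_density hβ (half_pos hL) (max (|v₀| + 2) |v₁|)
  obtain ⟨C, hC0, hC⟩ :=
    exists_holder_of_hasCompactSupport hβ wavelet_contDiff wavelet_hasCompactSupport
  obtain ⟨A, hA, hAm, hAC⟩ : ∃ A : ℝ, 0 < A ∧ 4 * A ≤ m ∧ A * C + A * C ≤ L / 2 := by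
    refine ⟨min (m / 4) (L / (4 * C)), by positivity, ?_, ?_⟩
    · linarith [min_le_left (m / 4) (L / (4 * C))]
    · have h := min_le_right (m / 4) (L / (4 * C))
      rw [le_div_iff₀ (by positivity)] at h
      linarith
  obtain ⟨h₀, hh₀, hh₀1, hh₀v⟩ : ∃ h₀ : ℝ, 0 < h₀ ∧ h₀ ≤ 1 ∧ (v₀ = 0 ∨ h₀ ≤ |v₀|) := by
    by_cases hv : v₀ = 0
    · exact ⟨1, one_pos, le_rfl, Or.inl hv⟩
    · exact ⟨min 1 |v₀|, lt_min one_pos (abs_pos.2 hv), min_le_left _ _,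
        Or.inr (min_le_right _ _)⟩
  set S := ∫ y, wavelet y ^ 2 with hS
  have hS0 : 0 ≤ S := integral_nonneg fun _ => sq_nonneg _
  set D := 4 * A ^ 2 * S / m with hDdef
  have hD : 0 ≤ D := by positivity
  refine ⟨A * h₀ ^ β * m / (Real.exp D + 1) / 2, by positivity, fun n hn T hT => ?_⟩
  have hn1 : (1 : ℝ) ≤ n := by exact_mod_cast hn
  have hn0 : (0 : ℝ) < n := by linarith
  have hβ2 : 0 < 2 * β + 1 := by linarith
  set k : ℝ := (n : ℝ) ^ (-(1 / (2 * β + 1))) with hk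
  have hk0 : 0 < k := by positivity
  have hk1 : k ≤ 1 := Real.rpow_le_one_of_one_le_of_nonpos hn1 (by
    rw [neg_nonpos]; positivity)
  have hkβ : k ^ β = (n : ℝ) ^ (-(β / (2 * β + 1))) := by
    rw [hk, ← Real.rpow_mul hn0.le]; congr 1; ring
  have hkn : k ^ (2 * β + 1) = (n : ℝ)⁻¹ := by
    rw [hk, ← Real.rpow_mul hn0.le, ← Real.rpow_neg_one]; congr 1; field_simp
  set h := h₀ * k with hh
  have hh0 : 0 < h := by positivity
  have hh1 : h ≤ 1 := mul_le_one₀ hh₀1 hk0.le hk1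
  have hhh₀ : h ≤ h₀ := mul_le_of_le_one_right hh₀.le hk1
  have hb : 0 ≤ A * h ^ β := by positivity
  have hs : 0 < h⁻¹ := inv_pos.2 hh0
  have hbA : A * h ^ β ≤ A :=
    mul_le_of_le_one_right hA.le (Real.rpow_le_one hh0.le hh1 hβ.le)
  set P := waveletPair (A * h ^ β) h⁻¹ (h⁻¹ * v₀) with hP
  have hPm : ∀ y, |P y| ≤ m := fun y =>
    (abs_waveletPair_le _ hb y).trans (by linarith)
  have hPg : ∀ y, P y ≠ 0 → g y = m := fun y hy => by
    refine hgm y ((abs_le_of_waveletPair_ne_zero _ hs hy).trans (le_trans ?_ (le_max_left _ _)))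
    rw [div_inv_eq_mul, abs_mul, abs_of_pos hs, add_mul, mul_right_comm, inv_mul_cancel₀ hh0.ne']
    linarith
  have hPD : (∫ y, P y ^ 2) / m ≤ D / n := by
    have h1 := integral_waveletPair_sq_le (h⁻¹ * v₀) hb hs
    have h2 : h ^ (2 * β + 1) ≤ (n : ℝ)⁻¹ := by
      rw [hh, Real.mul_rpow hh₀.le hk0.le, hkn]
      exact mul_le_of_le_one_left (by positivity) (Real.rpow_le_one hh₀.le hh₀1 hβ2.le)
    have h3 : h ^ (2 * β + 1) = (h ^ β) ^ 2 * h := by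
      rw [Real.rpow_add hh0, Real.rpow_one, mul_comm 2 β, Real.rpow_mul hh0.le,
        Real.rpow_two]
    calc (∫ y, P y ^ 2) / m ≤ (4 * (A * h ^ β) ^ 2 * h⁻¹⁻¹ * S) / m := by gcongr
      _ = D * h ^ (2 * β + 1) := by rw [h3, hDdef, inv_inv]; ring
      _ ≤ D * (n : ℝ)⁻¹ := by gcongr
      _ = D / n := (div_eq_mul_inv _ _).symm
  have hPv : A * h ^ β ≤ P v₀ := le_waveletPair_centre hb hs
    (hh₀v.imp id fun hv => by rw [inv_mul_eq_div, one_le_div hh0]; linarith)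
  have hPi : Integrable P := integrable_waveletPair _ hs
  have hP0 : ∫ y, P y = 0 := integral_waveletPair _ hs
  have hPc : Continuous P := waveletPair_continuous _
  have hg' := isContDensity_perturb hg hPc hPi hP0 hPm hPg
  have hlow := risk_add_risk_ge hp hQ hg hPc hPi (integrable_waveletPair_sq _ hb hs) hP0 hm hPm
    hPg hn hD hPD x hT
  have hgL' : holder β L g := holder_mono hgL (by linarith)
  have hF0 : memF β L {Q} (rotatedProduct Q g g) :=
    memF_rotatedProduct hQ hg hg hgL' hgL' hgs hgs
  have hF1 : memF β L {Q} (rotatedProduct Q (fun y => g y + P y) g) :=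
    memF_rotatedProduct hQ hg' hg
      (holder_mono (holder_add hgL (holder_waveletPair hβ hC hC0.le hA.le hh0 hh1 _))
        (by linarith)) hgL'
      (fun y => by rw [hgs, hP, waveletPair_neg]) hgs
  have hsup : ∀ f, memF β L {Q} f → risk p n x f T ≤
      ⨆ f ∈ {f : V2 → ℝ | memF β L {Q} f}, risk p n x f T := fun f hf =>
    le_iSup₂ (f := fun f (_ : f ∈ {f : V2 → ℝ | memF β L {Q} f}) => risk p n x f T) f hf
  have htwo := hlow.trans (add_le_add (hsup _ hF0) (hsup _ hF1))
  rw [← hv₀, ← hv₁, hgm v₁ (le_max_right _ _)] at htwo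
  set B : ℝ := A * h₀ ^ β * m / (Real.exp D + 1) / 2 * (n : ℝ) ^ (-(β / (2 * β + 1))) with hB
  have hBle : 2 * B ≤ |P v₀ * m| / (Real.exp D + 1) := by
    have h1 : A * h ^ β = A * h₀ ^ β * (n : ℝ) ^ (-(β / (2 * β + 1))) := by
      rw [hh, Real.mul_rpow hh₀.le hk0.le, hkβ, mul_assoc]
    calc 2 * B = A * h ^ β * m / (Real.exp D + 1) := by rw [hB, h1]; ring
      _ ≤ P v₀ * m / (Real.exp D + 1) := by gcongr
      _ ≤ _ := by gcongr; exact le_abs_self _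
  have hfin := (ENNReal.ofReal_le_ofReal hBle).trans htwo
  rw [← two_mul, ENNReal.ofReal_mul two_pos.le, ENNReal.ofReal_ofNat] at hfin
  exact (ENNReal.mul_le_mul_iff_right two_ne_zero ENNReal.ofNat_ne_top).1 hfin

end
end

section
/- (Commutativity property) For any rotation matrices D, Q ∈ 𝔪 and any f ∈ F(β,L,𝔪), E_f[f̃_{h,(D,Q)}(x)] = E_f[f̃_{h,(Q,D)}(x)]. -/
open MeasureTheory Matrix Filter
open scoped Classical ENNReal

noncomputable section

/-- Rotation matrices commute. -/
theorem IsRotation.mul_comm {D Q : Mat2} (hD : IsRotation D) (hQ : IsRotation Q) :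
    Q * D = D * Q := by
  rw [eta_fin_two D, eta_fin_two Q, hD.1, hD.2.1, hQ.1, hQ.2.1, mul_fin_two, mul_fin_two]
  congr 3 <;> grind

theorem p1_swap {D Q : Mat2} (hD : IsRotation D) (hQ : IsRotation Q) : p1 Q D = -p1 D Q := by
  simp only [p1, mcol, dotProduct, Fin.sum_univ_two, hD.1, hD.2.1, hQ.1, hQ.2.1]
  ring

theorem p2_swap (D Q : Mat2) : p2 Q D = p2 D Q :=
  dotProduct_comm _ _

theorem p1_sq_add_p2_sq {D Q : Mat2} (hD : IsRotation D) (hQ : IsRotation Q) :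
    p1 D Q ^ 2 + p2 D Q ^ 2 = 1 := by
  obtain ⟨hD₁, hD₂, hD₃⟩ := hD
  obtain ⟨hQ₁, hQ₂, hQ₃⟩ := hQ
  simp only [p1, p2, mcol, dotProduct, Fin.sum_univ_two]
  rw [hD₂, ← hD₁]
  linear_combination (D 0 0 ^ 2 + D 1 0 ^ 2) * hQ₃ + hD₃

/-- A density of the class `F` is an even function. -/
theorem memF.even {β L : ℝ} {S : Set Mat2} {f : V2 → ℝ} (hf : memF β L S f) (v : V2) :
    f (-v) = f v := by
  obtain ⟨g, ⟨g₁, g₂, -, -, -, -, h₁, h₂, -, -, hg⟩, M, -, -, hf⟩ := hf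
  simp only [hf, hg, mulVec_neg, Pi.neg_apply, h₁, h₂]

theorem memF.continuous {β L : ℝ} {S : Set Mat2} {f : V2 → ℝ} (hf : memF β L S f) :
    Continuous f := by
  obtain ⟨g, ⟨g₁, g₂, h₁, h₂, -, -, -, -, -, -, hg⟩, M, -, -, hf⟩ := hf
  have c₁ := h₁.1.continuous
  have c₂ := h₂.1.continuous
  have hfe : f = fun v => g₁ ((Mᵀ *ᵥ v) 0) * g₂ ((Mᵀ *ᵥ v) 1) := by
    ext v
    rw [hf, hg]
  rw [hfe]
  fun_prop

/-- A density of the class `F` defines a probability measure. -/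
theorem memF.isProbabilityMeasure {β L : ℝ} {S : Set Mat2} {f : V2 → ℝ} (hf : memF β L S f) :
    IsProbabilityMeasure (densM f) := by
  obtain ⟨g, ⟨g₁, g₂, h₁, h₂, n₁, n₂, -, -, i₁, i₂, hg⟩, M, -, hM, hf⟩ := hf
  have c₁ := h₁.1.continuous
  have c₂ := h₂.1.continuous
  have lint : ∀ w : ℝ → ℝ, (∀ y, 0 ≤ w y) → (∫ y, w y) = 1 →
      ∫⁻ y, ENNReal.ofReal (w y) = 1 := by
    intro w hw hi
    rw [← ofReal_integral_eq_lintegral_ofReal _ (ae_of_all _ hw), hi, ENNReal.ofReal_one]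
    by_contra hni
    rw [integral_undef hni] at hi
    exact zero_ne_one hi
  have hdet : Mᵀ.det = 1 := by
    obtain ⟨hM₁, hM₂, hM₃⟩ := hM
    rw [det_transpose, det_fin_two, ← hM₁, hM₂]
    linarith
  have hrot : MeasurePreserving (fun v : V2 => Mᵀ *ᵥ v) volume volume := by
    refine ⟨by fun_prop, ?_⟩
    have := Real.map_matrix_volume_pi_eq_smul_volume_pi (M := Mᵀ) (by simp [hdet])
    rw [hdet] at this
    simp only [inv_one, abs_one, ENNReal.ofReal_one, one_smul] at this
    exact this
  have hmeas : Measurable fun v : V2 => ENNReal.ofReal (g₁ (v 0)) * ENNReal.ofReal (g₂ (v 1)) := by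
    fun_prop
  refine ⟨?_⟩
  rw [densM, withDensity_apply _ MeasurableSet.univ, Measure.restrict_univ]
  calc ∫⁻ v, ENNReal.ofReal (f v)
      = ∫⁻ v : V2, ENNReal.ofReal (g₁ ((Mᵀ *ᵥ v) 0)) * ENNReal.ofReal (g₂ ((Mᵀ *ᵥ v) 1)) := by
        simp only [hf, hg, ENNReal.ofReal_mul (n₁ _)]
    _ = ∫⁻ v : V2, ENNReal.ofReal (g₁ (v 0)) * ENNReal.ofReal (g₂ (v 1)) :=
        hrot.lintegral_comp hmeas
    _ = ∫⁻ z : ℝ × ℝ, ENNReal.ofReal (g₁ z.1) * ENNReal.ofReal (g₂ z.2) :=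
        (volume_preserving_finTwoArrow ℝ).lintegral_comp
          (f := fun z : ℝ × ℝ => ENNReal.ofReal (g₁ z.1) * ENNReal.ofReal (g₂ z.2)) (by fun_prop)
    _ = 1 := by
        rw [Measure.volume_eq_prod, lintegral_prod_mul (f := fun y => ENNReal.ofReal (g₁ y))
          (g := fun y => ENNReal.ofReal (g₂ y)) (by fun_prop) (by fun_prop),
          lint g₁ n₁ i₁, lint g₂ n₂ i₂, one_mul]

/-- The law with an even density is invariant under reflection at the origin. -/
theorem measurePreserving_neg_densM {f : V2 → ℝ} (hf : Measurable f) (he : ∀ v, f (-v) = f v) :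
    MeasurePreserving (fun v : V2 => -v) (densM f) (densM f) := by
  refine ⟨measurable_neg, ?_⟩
  ext s hs
  rw [Measure.map_apply measurable_neg hs, densM, withDensity_apply _ hs,
    withDensity_apply _ (measurable_neg hs)]
  have := (Measure.measurePreserving_neg (volume : Measure V2)).setLIntegral_comp_preimage hs
    (f := fun y => ENNReal.ofReal (f y)) (by fun_prop)
  simpa only [he] using this

/-- The joint law of two distinct observations is the product law. -/
theorem measurePreserving_eval_pair {n : ℕ} {f : V2 → ℝ} [IsProbabilityMeasure (densM f)]
    {k l : Fin n} (hkl : k ≠ l) :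
    MeasurePreserving (fun ω : Fin n → V2 => (ω k, ω l)) (jointM n f)
      ((densM f).prod (densM f)) := by
  refine ⟨by fun_prop, ?_⟩
  have hind := (ProbabilityTheory.iIndepFun_pi (μ := fun _ : Fin n => densM f) (X := fun _ v => v)
    fun _ => aemeasurable_id).indepFun hkl
  have := hind.map_prod_eq_prod_map_map
    (measurable_pi_apply k).aemeasurable (measurable_pi_apply l).aemeasurable
  rw [jointM, this]
  congr 1
  · exact (measurePreserving_eval (fun _ : Fin n => densM f) k).map_eq
  · exact (measurePreserving_eval (fun _ : Fin n => densM f) l).map_eq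

theorem aestronglyMeasurable_Kh_linear {K : ℝ → ℝ} (hK : AEStronglyMeasurable K) {h : ℝ}
    (hh : h ≠ 0) (l : V2 × V2 →ₗ[ℝ] ℝ) (hl : l ≠ 0) (c : ℝ) :
    AEStronglyMeasurable (fun p => Kh K h (l p - c)) (volume.prod volume) := by
  have hc : Continuous l := l.continuous_of_finiteDimensional
  have h₁ : Measure.QuasiMeasurePreserving l (volume.prod volume) volume := by
    have : (volume : Measure (V2 × V2)).IsAddHaarMeasure :=
      Measure.prod.instIsAddHaarMeasure (volume : Measure V2) (volume : Measure V2)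
    obtain ⟨c, -, hmap⟩ := l.exists_map_addHaar_eq_smul_addHaar
      (volume : Measure (V2 × V2)) (volume : Measure ℝ) (LinearMap.surjective hl)
    exact ⟨hc.measurable, hmap ▸ Measure.smul_absolutelyContinuous⟩
  have h₂ : Measure.QuasiMeasurePreserving (fun u : ℝ => u - c) volume volume :=
    (measurePreserving_sub_right volume c).quasiMeasurePreserving
  have h₃ : Measure.QuasiMeasurePreserving (fun u : ℝ => u / h) volume volume := by
    simpa [div_eq_inv_mul] using
      Measure.quasiMeasurePreserving_smul (volume : Measure ℝ) (inv_ne_zero hh)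
  exact (hK.comp_quasiMeasurePreserving (h₃.comp (h₂.comp h₁))).const_mul _

theorem integrable_K2_pair {K : ℝ → ℝ} (hKi : Integrable K) (hKb : ∃ C, ∀ u, |K u| ≤ C)
    {h : ℝ} (hh : h ≠ 0) {f : V2 → ℝ} [IsProbabilityMeasure (densM f)] {a b : ℝ}
    (hab : a ^ 2 + b ^ 2 = 1) (e : V2) :
    Integrable (fun p : V2 × V2 => K2 K h (a • ((Ωm * Γm) *ᵥ p.1) + b • p.2 - e))
      ((densM f).prod (densM f)) := by
  obtain ⟨C, hC⟩ := hKb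
  have hac : (densM f).prod (densM f) ≪ (volume : Measure V2).prod volume :=
    (withDensity_absolutelyContinuous _ _).prod (withDensity_absolutelyContinuous _ _)
  have hmeas : ∀ i : Fin 2, AEStronglyMeasurable
      (fun p : V2 × V2 => Kh K h ((a • ((Ωm * Γm) *ᵥ p.1) + b • p.2 - e) i))
      ((densM f).prod (densM f)) := by
    intro i
    let l : V2 × V2 →ₗ[ℝ] ℝ := LinearMap.proj i ∘ₗ
      (a • ((Ωm * Γm).mulVecLin ∘ₗ LinearMap.fst ℝ V2 V2) + b • LinearMap.snd ℝ V2 V2)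
    refine AEStronglyMeasurable.mono_ac hac
      (aestronglyMeasurable_Kh_linear hKi.aestronglyMeasurable hh l ?_ (e i))
    intro hl
    have ha : a = 0 := by
      fin_cases i
      · simpa [l, Ωm, Γm] using LinearMap.congr_fun hl (![0, 1], 0)
      · simpa [l, Ωm, Γm] using LinearMap.congr_fun hl (![1, 0], 0)
    have hb : b = 0 := by simpa [l] using LinearMap.congr_fun hl (0, fun _ => 1)
    simp [ha, hb] at hab
  have hbound : ∀ u, ‖Kh K h u‖ ≤ |h⁻¹| * C := fun u => by
    rw [Kh, Real.norm_eq_abs, abs_mul]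
    gcongr
    exact hC _
  refine Integrable.of_bound ((hmeas 0).mul (hmeas 1)) (|h⁻¹| * C * (|h⁻¹| * C))
    (ae_of_all _ fun p => ?_)
  rw [K2, norm_mul]
  exact mul_le_mul (hbound _) (hbound _) (norm_nonneg _) ((norm_nonneg _).trans (hbound 0))

/-- The mean of the auxiliary estimator as a sum of integrals over pairs of observations. -/
theorem integral_auxEstI {K : ℝ → ℝ} (hKi : Integrable K) (hKb : ∃ C, ∀ u, |K u| ≤ C)
    {h : ℝ} (hh : h ≠ 0) {D Q : Mat2} (hD : IsRotation D) (hQ : IsRotation Q) (x : V2)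
    {n : ℕ} {f : V2 → ℝ} [IsProbabilityMeasure (densM f)] (I : Finset (Fin n)) :
    (∫ ω, auxEstI K h D Q x I ω ∂jointM n f) =
      ((I.card : ℝ) * ((I.card : ℝ) - 1))⁻¹ * ∑ k ∈ I, ∑ l ∈ I, if k = l then 0 else
        ∫ p : V2 × V2, K2 K h (p1 D Q • ((Ωm * Γm) *ᵥ p.1) + p2 D Q • p.2 -
          (Ωm * Γm * Q * D * Ωm) *ᵥ x) ∂(densM f).prod (densM f) := by
  have hint := integrable_K2_pair (f := f) hKi hKb hh (p1_sq_add_p2_sq hD hQ)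
    ((Ωm * Γm * Q * D * Ωm) *ᵥ x)
  have hterm : ∀ k l : Fin n, Integrable (fun ω : Fin n → V2 => if k = l then 0 else
      K2 K h (p1 D Q • ((Ωm * Γm) *ᵥ ω k) + p2 D Q • ω l - (Ωm * Γm * Q * D * Ωm) *ᵥ x))
      (jointM n f) := by
    intro k l
    by_cases hkl : k = l
    · simp [hkl]
    · simp only [hkl, if_false]
      exact (measurePreserving_eval_pair hkl).integrable_comp_of_integrable hint
  unfold auxEstI
  rw [integral_const_mul, integral_finsetSum _ fun k _ => integrable_finsetSum _ fun l _ =>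
    hterm k l]
  congr 1
  refine Finset.sum_congr rfl fun k _ => ?_
  rw [integral_finsetSum _ fun l _ => hterm k l]
  refine Finset.sum_congr rfl fun l _ => ?_
  by_cases hkl : k = l
  · simp [hkl]
  · simp only [hkl, if_false]
    have hmp := measurePreserving_eval_pair (f := f) hkl
    rw [← hmp.map_eq] at hint ⊢
    rw [integral_map hmp.measurable.aemeasurable hint.aestronglyMeasurable]

/-- Lemma 3, commutativity property:
`E_f[f̃_{h,(D,Q)}(x)] = E_f[f̃_{h,(Q,D)}(x)]`. -/
theorem statement8 (β L h : ℝ) (hβ : 0 < β) (hL : 0 < L) (hh : 0 < h)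
    (n : ℕ) (hn : 3 ≤ n) (K : ℝ → ℝ) (hKi : Integrable K) (hKb : ∃ C, ∀ u, |K u| ≤ C)
    (D Q : Mat2) (hD : IsRotation D) (hQ : IsRotation Q) (x : V2)
    (f : V2 → ℝ) (hf : memF β L {M : Mat2 | IsRotation M} f) :
    (∫ ω, pairEstI K h D Q x Finset.univ ω ∂jointM n f) =
      ∫ ω, pairEstI K h Q D x Finset.univ ω ∂jointM n f := by
  have hprob := hf.isProbabilityMeasure
  by_cases hDQ : D = Q
  · rw [hDQ]
  simp only [pairEstI, hDQ, Ne.symm hDQ, if_false]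
  rw [integral_auxEstI hKi hKb hh.ne' hD hQ, integral_auxEstI hKi hKb hh.ne' hQ hD]
  have hx : Ωm * Γm * D * Q * Ωm = Ωm * Γm * Q * D * Ωm := by
    rw [Matrix.mul_assoc (Ωm * Γm) D Q, ← hD.mul_comm hQ, ← Matrix.mul_assoc]
  have hneg := (measurePreserving_neg_densM hf.continuous.measurable hf.even).prod
    (MeasurePreserving.id (densM f))
  have hemb : MeasurableEmbedding (Prod.map (fun v : V2 => -v) (id : V2 → V2)) :=
    ((MeasurableEquiv.neg V2).prodCongr (MeasurableEquiv.refl V2)).measurableEmbedding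
  have hpair := hneg.integral_comp hemb fun p : V2 × V2 =>
    K2 K h (p1 D Q • ((Ωm * Γm) *ᵥ p.1) + p2 D Q • p.2 - (Ωm * Γm * Q * D * Ωm) *ᵥ x)
  simp only [Prod.map_fst, Prod.map_snd, id_eq, mulVec_neg, smul_neg] at hpair
  rw [hx, p1_swap hD hQ, p2_swap D Q]
  simp only [neg_smul, hpair]

end
end
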